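/- Let ν > -1 be a real number and let x > 0 be such that J_ν(x) ≠ 0. Then the sum over all positive zeros j of J_ν of 1/(j⁴ − x⁴) equals (1/(4x³)) · ( J_{ν+1}(x)/J_ν(x) − I_{ν+1}(x)/I_ν(x) ). -/

import Mathlib

/-- The Bessel function of the first kind of order `ν`, defined for `x > 0` by its series. -/
noncomputable def besselJ (ν x : ℝ) : ℝ :=
  ∑' m : ℕ, ((-1 : ℝ) ^ m / (m.factorial * Real.Gamma (m + ν + 1))) *
    (x / 2) ^ (2 * (m : ℝ) + ν)

/-- The modified Bessel function of the first kind of order `ν`, defined for `x > 0`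
by its series. -/
noncomputable def besselI (ν x : ℝ) : ℝ :=
  ∑' m : ℕ, (1 / (m.factorial * Real.Gamma (m + ν + 1))) *
    (x / 2) ^ (2 * (m : ℝ) + ν)

open Filter Topology Metric

lemma ml_factor (F : ℂ → ℂ) (hF : Differentiable ℂ F) (h0 : F 0 ≠ 0)
    (hs : ∀ z, F z = 0 → deriv F z ≠ 0) (S : Finset ℂ) (hS : ∀ z ∈ S, F z = 0) :
    ∃ G : ℂ → ℂ, Differentiable ℂ G ∧ (∀ z, F z = (∏ a ∈ S, (1 - z / a)) * G z) ∧
      ∀ z ∈ S, G z ≠ 0 := by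
  induction S using Finset.induction_on with
  | empty => exact ⟨F, hF, by simp, by simp⟩
  | insert a S ha ih =>
    obtain ⟨G, hG, hFG, hne⟩ := ih (fun z hz => hS z (Finset.mem_insert_of_mem hz))
    have hnz : ∀ z ∈ insert a S, z ≠ 0 := by
      rintro z hz rfl
      exact h0 (hS _ hz)
    have ha0 : a ≠ 0 := hnz a (Finset.mem_insert_self _ _)
    have hFa : F a = 0 := hS a (Finset.mem_insert_self _ _)
    have hPa : (∏ b ∈ S, (1 - a / b)) ≠ 0 := by
      rw [Finset.prod_ne_zero_iff]
      intro b hb h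
      have hb0 := hnz b (Finset.mem_insert_of_mem hb)
      have : a = b := by
        field_simp at h
        linear_combination -h
      exact ha (this ▸ hb)
    have hGa : G a = 0 := by
      have := hFG a
      rw [hFa] at this
      simpa [hPa] using this.symm
    have hdG : Differentiable ℂ (dslope G a) := by
      have := (Complex.differentiableOn_dslope (s := Set.univ) (c := a) (f := G) univ_mem).2
        hG.differentiableOn
      exact differentiableOn_univ.1 this
    have hGd : ∀ z, G z = (z - a) * dslope G a z := by
      intro z
      have := sub_smul_dslope G a z
      rw [hGa, sub_zero, smul_eq_mul] at this
      exact this.symm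
    have hda : deriv G a ≠ 0 := by
      intro h
      apply hs a hFa
      have h1 : HasDerivAt (fun z => ∏ b ∈ S, (1 - z / b)) (deriv (fun z => ∏ b ∈ S, (1 - z / b)) a) a := by
        apply DifferentiableAt.hasDerivAt
        fun_prop
      have h2 := h1.mul (hG a).hasDerivAt
      have h3 : F = (fun z => ∏ b ∈ S, (1 - z / b)) * G := by
        funext z; exact hFG z
      rw [← h3] at h2
      rw [h2.deriv, hGa, h]
      simp
    refine ⟨fun z => -a * dslope G a z, by fun_prop, ?_, ?_⟩
    · intro z
      rw [hFG z, Finset.prod_insert ha, hGd z]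
      field_simp
      ring
    · intro z hz
      rw [Finset.mem_insert] at hz
      rcases hz with rfl | hz
      · simp [dslope_same, hda, ha0]
      · have := hne z hz
        rw [hGd z] at this
        exact mul_ne_zero (neg_ne_zero.2 ha0) (right_ne_zero_of_mul this)

lemma ml_log (G : ℂ → ℂ) (hG : Differentiable ℂ G) (R A : ℝ) (hR : 0 < R) (hA : 0 < A)
    (hne : ∀ z ∈ ball (0:ℂ) R, G z ≠ 0)
    (hb : ∀ z ∈ ball (0:ℂ) R, ‖G z‖ ≤ ‖G 0‖ * Real.exp A) (w : ℂ) (hw : ‖w‖ ≤ R / 4) :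
    ‖deriv G w / G w‖ ≤ 8 * A / R := by
  have h00 : (0:ℂ) ∈ ball (0:ℂ) R := by simpa using hR
  have hd : DifferentiableOn ℂ (fun z => deriv G z / G z) (ball 0 R) := by
    apply DifferentiableOn.div _ hG.differentiableOn hne
    exact hG.differentiableOn.deriv isOpen_ball
  obtain ⟨g, hg0, hg⟩ := hd.isExactOn_ball.with_val_at 0 0
  have hgd : DifferentiableOn ℂ g (ball 0 R) := fun z hz =>
    (hg z hz).differentiableAt.differentiableWithinAt
  have key : ∀ z ∈ ball (0:ℂ) R, G z = G 0 * Complex.exp (g z) := by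
    have hq : ∀ z ∈ ball (0:ℂ) R, HasDerivAt (fun z => G z * Complex.exp (-g z)) 0 z := by
      intro z hz
      have := (hG z).hasDerivAt.mul ((hg z hz).neg.cexp)
      refine this.congr_deriv ?_
      have := hne z hz
      have h' : G z * (deriv G z / G z) = deriv G z := by field_simp
      linear_combination -Complex.exp (-g z) * h'
    intro z hz
    have := (convex_ball (0:ℂ) R).is_const_of_fderivWithin_eq_zero (𝕜 := ℂ)
      (f := fun z => G z * Complex.exp (-g z))
      (fun z hz => (hq z hz).differentiableAt.differentiableWithinAt)
      (fun z hz => by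
        rw [fderivWithin_of_isOpen isOpen_ball hz]
        have := (hq z hz).hasFDerivAt.fderiv
        rw [this]; ext; simp) hz h00
    simp only [hg0, neg_zero, Complex.exp_zero, mul_one] at this
    rw [← this, mul_assoc, ← Complex.exp_add]
    simp
  have hre : Set.MapsTo g (ball 0 R) {z | z.re ≤ A} := by
    intro z hz
    have h1 := hb z hz
    rw [key z hz, norm_mul, Complex.norm_exp] at h1
    have h2 : 0 < ‖G 0‖ := norm_pos_iff.2 (hne 0 h00)
    exact Real.exp_le_exp.1 (le_of_mul_le_mul_left h1 h2)
  have hbd : ∀ z, ‖z‖ ≤ R / 2 → ‖g z‖ ≤ 2 * A := by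
    intro z hz
    have := Complex.borelCaratheodory_zero hA hgd hre hR (z := z) (by simp; linarith) hg0
    refine this.trans ?_
    rw [div_le_iff₀ (by linarith)]
    nlinarith
  have hsub : closedBall w (R/4) ⊆ ball 0 R := by
    intro z hz
    have := norm_le_norm_add_norm_sub w z
    rw [mem_closedBall, dist_eq_norm] at hz
    simp
    rw [norm_sub_rev] at this
    linarith
  have hc := Complex.norm_deriv_le_of_forall_mem_sphere_norm_le (f := g) (c := w) (R := R/4) (C := 2*A)
    (by linarith) (by
      apply DifferentiableOn.diffContOnCl
      rw [closure_ball _ (by positivity)]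
      exact hgd.mono hsub) (by
      intro z hz
      apply hbd
      have := norm_le_norm_add_norm_sub w z
      rw [mem_sphere, dist_eq_norm, norm_sub_rev] at hz
      rw [norm_sub_rev] at hz
      linarith [norm_sub_rev w z])
  rw [(hg w (hsub (mem_closedBall_self (by positivity)))).deriv] at hc
  refine hc.trans (le_of_eq ?_)
  field_simp
  ring

lemma ml_estimate (F : ℂ → ℂ) (hF : Differentiable ℂ F) (h0 : F 0 ≠ 0)
    (hs : ∀ z, F z = 0 → deriv F z ≠ 0) (R A : ℝ) (hR : 0 < R) (hA : 0 < A)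
    (S : Finset ℂ) (hS : ∀ z, z ∈ S ↔ F z = 0 ∧ ‖z‖ ≤ R)
    (hb : ∀ z, ‖z‖ = 2 * R → ‖F z‖ ≤ ‖F 0‖ * Real.exp A) (w : ℂ) (hw : ‖w‖ ≤ R / 4)
    (hFw : F w ≠ 0) :
    ‖deriv F w / F w - ∑ a ∈ S, 1 / (w - a)‖ ≤ 8 * A / R := by
  obtain ⟨G, hG, hFG, hne⟩ := ml_factor F hF h0 hs S (fun z hz => ((hS z).1 hz).1)
  have hnz : ∀ z ∈ S, z ≠ 0 := by
    rintro z hz rfl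
    exact h0 ((hS _).1 hz).1
  have hG0 : F 0 = G 0 := by simpa using hFG 0
  have hGne : ∀ z ∈ ball (0:ℂ) R, G z ≠ 0 := by
    intro z hz h
    have hz' : z ∈ S := (hS z).2 ⟨by rw [hFG, h, mul_zero], by simpa using (mem_ball_zero_iff.1 hz).le⟩
    exact hne z hz' h
  have hGb : ∀ z ∈ closedBall (0:ℂ) (2*R), ‖G z‖ ≤ ‖G 0‖ * Real.exp A := by
    have h2 : (2 * R) ≠ 0 := by positivity
    intro z hz
    rw [← closure_ball _ h2] at hz
    refine Complex.norm_le_of_forall_mem_frontier_norm_le (isBounded_ball) hG.diffContOnCl ?_ hz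
    intro z hz
    rw [frontier_ball _ h2, mem_sphere_zero_iff_norm] at hz
    have h3 := hb z hz
    rw [hFG z, norm_mul, hG0] at h3
    refine le_trans ?_ h3
    apply le_mul_of_one_le_left (norm_nonneg _)
    rw [norm_prod]
    apply Finset.one_le_prod
    intro a ha
    have ha0 : 0 < ‖a‖ := norm_pos_iff.2 (hnz a ha)
    have haR := ((hS a).1 ha).2
    have h4 : (2:ℝ) ≤ ‖z / a‖ := by
      rw [norm_div, le_div_iff₀ ha0, hz]; linarith
    have h5 := norm_sub_norm_le (z / a) 1
    rw [norm_sub_rev, norm_one] at h5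
    linarith
  have hlog := ml_log G hG R A hR hA hGne (fun z hz => hGb z
    (by rw [mem_ball_zero_iff] at hz; rw [mem_closedBall_zero_iff]; linarith)) w hw
  convert hlog using 2
  have hGw : G w ≠ 0 := by
    intro h; apply hFw; rw [hFG, h, mul_zero]
  have hPw : ∀ a ∈ S, 1 - w / a ≠ 0 := by
    have : (∏ a ∈ S, (1 - w / a)) ≠ 0 := by
      intro h; apply hFw; rw [hFG, h, zero_mul]
    exact Finset.prod_ne_zero_iff.1 this
  have e1 : deriv F w / F w = logDeriv F w := rfl
  have e2 : deriv G w / G w = logDeriv G w := rfl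
  have e3 : F = fun z => (fun z => ∏ a ∈ S, (1 - z / a)) z * G z := funext hFG
  rw [e1, e2, e3, logDeriv_mul w (Finset.prod_ne_zero_iff.2 hPw) hGw (by fun_prop) (hG w),
    logDeriv_prod (f := fun (a z : ℂ) => 1 - z / a) hPw (by fun_prop)]
  have : ∀ a ∈ S, logDeriv (fun z => 1 - z / a) w = 1 / (w - a) := by
    intro a ha
    have hd : HasDerivAt (fun z : ℂ => 1 - z / a) (-(1 / a)) w :=
      ((hasDerivAt_id w).div_const a).const_sub 1
    rw [logDeriv_apply, hd.deriv]
    have h1 := hPw a ha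
    have h2 := hnz a ha
    have h3 : a - w ≠ 0 := by
      intro h; apply h1; field_simp; simpa using h
    have h4 : w - a ≠ 0 := by
      intro h; apply h3; linear_combination -h
    field_simp
    ring
  rw [Finset.sum_congr rfl this]
  ring

lemma ml_tendsto (F : ℂ → ℂ) (hF : Differentiable ℂ F) (h0 : F 0 ≠ 0)
    (hs : ∀ z, F z = 0 → deriv F z ≠ 0)
    (hg : ∀ ε > 0, ∃ C > 0, ∀ z, ‖F z‖ ≤ C * Real.exp (ε * ‖z‖))
    (S : ℕ → Finset ℂ) (hS : ∀ n z, z ∈ S n ↔ F z = 0 ∧ ‖z‖ ≤ n) (w : ℂ) (hFw : F w ≠ 0) :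
    Tendsto (fun n => ∑ a ∈ S n, 1 / (w - a)) atTop (𝓝 (deriv F w / F w)) := by
  rw [Metric.tendsto_atTop]
  intro ε hε
  obtain ⟨C, hC, hCb⟩ := hg (ε / 32) (by positivity)
  have hF0 : 0 < ‖F 0‖ := norm_pos_iff.2 h0
  obtain ⟨N, hN⟩ := exists_nat_gt (max (max 1 (4 * ‖w‖)) (32 * |Real.log (C / ‖F 0‖)| / ε))
  refine ⟨N, fun n hn => ?_⟩
  have hn' : (N:ℝ) ≤ n := by exact_mod_cast hn
  rw [max_lt_iff, max_lt_iff] at hN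
  obtain ⟨⟨hN1, hN2⟩, hN3⟩ := hN
  have hnpos : (0:ℝ) < n := by linarith
  rw [div_lt_iff₀ hε] at hN3
  have habs := le_abs_self (Real.log (C / ‖F 0‖))
  have hnε : (N:ℝ) * ε ≤ n * ε := by gcongr
  have := ml_estimate F hF h0 hs n (ε * n / 16 + |Real.log (C / ‖F 0‖)|) hnpos (by positivity)
    (S n) (hS n) (by
      intro z hz
      refine (hCb z).trans ?_
      have : C = ‖F 0‖ * Real.exp (Real.log (C / ‖F 0‖)) := by
        rw [Real.exp_log (by positivity)]; field_simp
      have h2 : C * Real.exp (ε / 32 * ‖z‖)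
          = ‖F 0‖ * Real.exp (Real.log (C / ‖F 0‖) + ε / 32 * ‖z‖) := by
        rw [Real.exp_add, ← mul_assoc, ← this]
      rw [h2, hz]
      apply mul_le_mul_of_nonneg_left _ hF0.le
      apply Real.exp_le_exp.2
      linarith) w (by linarith) hFw
  rw [dist_comm, dist_eq_norm]
  refine this.trans_lt ?_
  rw [div_lt_iff₀ hnpos]
  nlinarith

lemma hasSum_of_exhaust {ι : Type*} (f : ι → ℝ) (T : ℕ → Finset ι) (hT : Monotone T)
    (hTe : ∀ i, ∃ n, i ∈ T n) (L : ℝ) (hL : Tendsto (fun n => ∑ i ∈ T n, f i) atTop (𝓝 L))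
    (n₀ : ℕ) (hpos : ∀ i ∉ T n₀, 0 ≤ f i) : HasSum f L := by
  classical
  have hTt : Tendsto T atTop atTop := tendsto_atTop_finset_of_monotone hT hTe
  have hsum : Summable f := by
    apply Summable.of_norm
    obtain ⟨B, hB⟩ := hL.bddAbove_range
    apply summable_of_sum_le (c := B + ∑ i ∈ T n₀, (|f i| - f i)) (fun i => norm_nonneg _)
    intro u
    obtain ⟨n, hn⟩ := (hTt.eventually (eventually_ge_atTop (u ∪ T n₀))).exists
    have hu : u ⊆ T n := Finset.subset_union_left.trans hn
    have h0 : T n₀ ⊆ T n := Finset.subset_union_right.trans hn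
    calc ∑ i ∈ u, ‖f i‖ ≤ ∑ i ∈ T n, ‖f i‖ :=
          Finset.sum_le_sum_of_subset_of_nonneg hu (fun i _ _ => norm_nonneg _)
      _ = ∑ i ∈ T n, f i + ∑ i ∈ T n, (|f i| - f i) := by
          rw [← Finset.sum_add_distrib]; apply Finset.sum_congr rfl; intro i _; simp
      _ = ∑ i ∈ T n, f i + ∑ i ∈ T n₀, (|f i| - f i) := by
          congr 1; symm
          apply Finset.sum_subset h0
          intro i _ hi
          rw [abs_of_nonneg (hpos i hi), sub_self]
      _ ≤ _ := by
          gcongr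
          exact hB ⟨n, rfl⟩
  have := hsum.hasSum.comp hTt
  rw [tendsto_nhds_unique hL this]
  exact hsum.hasSum

noncomputable def bc (μ : ℝ) (m : ℕ) : ℝ := (-1/4)^m / (m.factorial * Real.Gamma (m + μ + 1))

noncomputable def bF (μ : ℝ) (z : ℂ) : ℂ := ∑' m : ℕ, (bc μ m : ℂ) * z ^ m

lemma gam_pos (μ : ℝ) (hμ : -1 < μ) (m : ℕ) : 0 < Real.Gamma (m + μ + 1) :=
  Real.Gamma_pos_of_pos (by have : (0:ℝ) ≤ m := m.cast_nonneg; linarith)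

lemma pow_div_gam (μ : ℝ) (hμ : -1 < μ) (r : ℝ) (hr : 0 < r) :
    Summable (fun m : ℕ => r ^ m / Real.Gamma (m + μ + 1)) := by
  apply summable_of_ratio_test_tendsto_lt_one (l := 0) zero_lt_one
  · filter_upwards with m
    have := gam_pos μ hμ m
    positivity
  · have h : ∀ m : ℕ, ‖r ^ (m+1) / Real.Gamma ((m+1 : ℕ) + μ + 1)‖ / ‖r ^ m / Real.Gamma (m + μ + 1)‖
        = r / (m + (μ + 1)) := by
      intro m
      have h1 := gam_pos μ hμ m
      have h2 := gam_pos μ hμ (m+1)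
      have h3 : (0:ℝ) < m + μ + 1 := by have : (0:ℝ) ≤ m := m.cast_nonneg; linarith
      rw [Real.norm_of_nonneg (by positivity), Real.norm_of_nonneg (by positivity)]
      have : ((m+1 : ℕ) + μ + 1 : ℝ) = (m + μ + 1) + 1 := by push_cast; ring
      rw [this, Real.Gamma_add_one h3.ne']
      have h4 : (m + (μ + 1) : ℝ) = m + μ + 1 := by ring
      rw [h4]
      field_simp
      ring
    simp_rw [h]
    apply Tendsto.const_div_atTop
    exact tendsto_atTop_add_const_right _ _ tendsto_natCast_atTop_atTop

lemma bc_bound (μ : ℝ) (hμ : -1 < μ) (ε : ℝ) (hε : 0 < ε) :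
    ∃ C > 0, ∀ m, |bc μ m| ≤ C * (ε ^ m / m.factorial) := by
  obtain ⟨B, hB⟩ := (pow_div_gam μ hμ (1/(4*ε)) (by positivity)).tendsto_atTop_zero.bddAbove_range
  refine ⟨max B 1, by positivity, fun m => ?_⟩
  have h1 : (1/(4*ε)) ^ m / Real.Gamma (m + μ + 1) ≤ B := hB ⟨m, rfl⟩
  have h2 := gam_pos μ hμ m
  have h3 : |bc μ m| = ((1/(4*ε)) ^ m / Real.Gamma (m + μ + 1)) * (ε ^ m / m.factorial) := by
    unfold bc
    have e : |(-1/4 : ℝ)| = 1/4 := by norm_num [abs_div]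
    rw [abs_div, abs_pow, e, abs_of_pos (by positivity : 0 < m.factorial * Real.Gamma (m + μ + 1))]
    have : ((1/4 : ℝ))^m = (1/(4*ε))^m * ε^m := by
      rw [← mul_pow]; congr 1; field_simp
    rw [this]
    field_simp
  rw [h3]
  gcongr
  exact h1.trans (le_max_left _ _)

lemma bc_summable (μ : ℝ) (hμ : -1 < μ) (r : ℝ) (hr : 0 ≤ r) :
    Summable (fun m => |bc μ m| * r ^ m) := by
  obtain ⟨C, hC, h⟩ := bc_bound μ hμ 1 one_pos
  refine Summable.of_nonneg_of_le (fun m => by positivity) (fun m => ?_)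
    ((Real.summable_pow_div_factorial r).mul_left C)
  calc |bc μ m| * r ^ m ≤ C * (1 ^ m / m.factorial) * r ^ m := by gcongr; exact h m
    _ = C * (r ^ m / m.factorial) := by rw [one_pow]; ring

lemma bF_norm_summable (μ : ℝ) (hμ : -1 < μ) (z : ℂ) :
    Summable (fun m => ‖(bc μ m : ℂ) * z ^ m‖) := by
  simpa using bc_summable μ hμ ‖z‖ (norm_nonneg z)

lemma bF_summable (μ : ℝ) (hμ : -1 < μ) (z : ℂ) :
    Summable (fun m => (bc μ m : ℂ) * z ^ m) := (bF_norm_summable μ hμ z).of_norm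

lemma bF_growth (μ : ℝ) (hμ : -1 < μ) (ε : ℝ) (hε : ε > 0) :
    ∃ C > 0, ∀ z, ‖bF μ z‖ ≤ C * Real.exp (ε * ‖z‖) := by
  obtain ⟨C, hC, h⟩ := bc_bound μ hμ ε hε
  refine ⟨C, hC, fun z => ?_⟩
  refine (norm_tsum_le_tsum_norm (bF_norm_summable μ hμ z)).trans ?_
  have hs : HasSum (fun m : ℕ => C * ((ε * ‖z‖) ^ m / m.factorial)) (C * Real.exp (ε * ‖z‖)) := by
    apply HasSum.mul_left
    rw [Real.exp_eq_exp_ℝ]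
    exact NormedSpace.expSeries_div_hasSum_exp (ε * ‖z‖)
  rw [← hs.tsum_eq]
  refine Summable.tsum_le_tsum (fun m => ?_) (bF_norm_summable μ hμ z) hs.summable
  rw [norm_mul, norm_pow, Complex.norm_real, Real.norm_eq_abs]
  calc |bc μ m| * ‖z‖ ^ m ≤ C * (ε ^ m / m.factorial) * ‖z‖ ^ m := by gcongr; exact h m
    _ = _ := by rw [mul_pow]; ring

lemma bc_succ (μ : ℝ) (m : ℕ) : bc μ (m+1) * (m + 1) = (-1/4) * bc (μ+1) m := by
  unfold bc
  have e : ((m+1 : ℕ) + μ + 1 : ℝ) = m + (μ + 1) + 1 := by push_cast; ring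
  rw [e, Nat.factorial_succ, pow_succ]
  push_cast
  have h0 : ((m.factorial : ℝ)) ≠ 0 := by positivity
  have h1 : (m + 1 : ℝ) ≠ 0 := by positivity
  by_cases h2 : Real.Gamma (m + (μ + 1) + 1) = 0
  · simp [h2]
  · field_simp

lemma bF_hasDerivAt (μ : ℝ) (hμ : -1 < μ) (z : ℂ) :
    HasDerivAt (bF μ) ((-1/4) * bF (μ+1) z) z := by
  set R := ‖z‖ + 1
  have hR : 0 < R := by positivity
  have hbs := bc_summable (μ+1) (by linarith) R hR.le
  have hu : Summable (fun m : ℕ => |bc μ m| * (m * R ^ (m-1))) := by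
    rw [← summable_nat_add_iff 1]
    refine (hbs.mul_left (1/4)).congr ?_
    intro m
    have := congrArg abs (bc_succ μ m)
    rw [abs_mul, abs_mul, abs_of_pos (by positivity : (0:ℝ) < m + 1)] at this
    have e : |(-1/4 : ℝ)| = 1/4 := by norm_num [abs_div]
    rw [e] at this
    push_cast
    linear_combination -R^m * this
  have key := hasDerivAt_tsum_of_isPreconnected (u := fun m : ℕ => |bc μ m| * (m * R ^ (m-1)))
    (g := fun m z => (bc μ m : ℂ) * z ^ m)
    (g' := fun m z => (bc μ m : ℂ) * (m * z ^ (m-1)))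
    (t := ball (0:ℂ) R) hu isOpen_ball (convex_ball _ _).isPreconnected
    (fun m y _ => (hasDerivAt_pow m y).const_mul _)
    (fun m y hy => by
      rw [mem_ball_zero_iff] at hy
      simp only [norm_mul, norm_pow, Complex.norm_real, Real.norm_eq_abs, Complex.norm_natCast]
      gcongr)
    (y₀ := 0) (mem_ball_self hR) (bF_summable μ hμ 0) (y := z) (by
      rw [mem_ball_zero_iff]; simp [R])
  refine key.congr_deriv ?_
  rw [tsum_eq_zero_add' ?_]
  · simp only [Nat.cast_zero, zero_mul, mul_zero, zero_add, Nat.add_sub_cancel]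
    unfold bF
    rw [← tsum_mul_left]
    congr 1; funext m
    have := congrArg (fun t : ℝ => (t : ℂ)) (bc_succ μ m)
    push_cast at this ⊢
    linear_combination z^m * this
  · refine ((bF_summable (μ+1) (by linarith) z).mul_left (-1/4)).congr ?_
    intro m
    have := congrArg (fun t : ℝ => (t : ℂ)) (bc_succ μ m)
    push_cast at this ⊢
    linear_combination -z^m * this

lemma bF_differentiable (μ : ℝ) (hμ : -1 < μ) : Differentiable ℂ (bF μ) :=
  fun z => (bF_hasDerivAt μ hμ z).differentiableAt

lemma bc_rel (μ : ℝ) (hμ : -1 < μ) (m : ℕ) : bc μ m = (m + μ + 1) * bc (μ+1) m := by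
  unfold bc
  have h3 : (0:ℝ) < m + μ + 1 := by have : (0:ℝ) ≤ m := m.cast_nonneg; linarith
  have e : (m + (μ + 1) + 1 : ℝ) = (m + μ + 1) + 1 := by ring
  rw [e, Real.Gamma_add_one h3.ne']
  have := gam_pos μ hμ m
  field_simp

lemma bF_rel (μ : ℝ) (hμ : -1 < μ) (z : ℂ) :
    bF μ z = (μ + 1) * bF (μ+1) z - z / 4 * bF (μ+2) z := by
  have hs : HasSum (fun m : ℕ => (m : ℂ) * (bc (μ+1) m : ℂ) * z ^ m) (-(z / 4) * bF (μ+2) z) := by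
    rw [← hasSum_nat_add_iff' 1]
    simp only [Finset.sum_range_one, Nat.cast_zero, zero_mul, sub_zero]
    have := (bF_summable (μ+2) (by linarith) z).hasSum.mul_left (-(z / 4))
    refine this.congr_fun ?_
    intro m
    have := congrArg (fun t : ℝ => (t : ℂ)) (bc_succ (μ+1) m)
    have e : μ + 1 + 1 = μ + 2 := by ring
    rw [e] at this
    push_cast at this ⊢
    rw [pow_succ]
    linear_combination z^m * z * this
  have h1 := (bF_summable (μ+1) (by linarith) z).hasSum.mul_left ((μ:ℂ) + 1)
  have h2 := (h1.add hs).tsum_eq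
  have h3 : bF (μ+1) z = ∑' m : ℕ, (bc (μ+1) m : ℂ) * z ^ m := rfl
  rw [h3, sub_eq_add_neg, ← neg_mul, ← h2]
  unfold bF
  congr 1; funext m
  have := congrArg (fun t : ℝ => (t : ℂ)) (bc_rel μ hμ m)
  push_cast at this
  rw [this]
  ring

lemma bF_zero (μ : ℝ) (hμ : -1 < μ) : bF μ 0 ≠ 0 := by
  unfold bF
  rw [tsum_eq_single 0 (fun m hm => by simp [hm])]
  have := gam_pos μ hμ 0
  simp only [Nat.cast_zero, zero_add] at this
  simp [bc, this.ne']

lemma bF_iter (μ : ℝ) (hμ : -1 < μ) (n : ℕ) :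
    iteratedDeriv n (bF μ) = fun z => (-1/4) ^ n * bF (μ + n) z := by
  induction n with
  | zero => simp
  | succ n ih =>
    rw [iteratedDeriv_succ, ih]
    funext z
    have hn : (0:ℝ) ≤ n := n.cast_nonneg
    rw [((bF_hasDerivAt (μ+n) (by linarith) z).const_mul _).deriv]
    push_cast
    rw [← add_assoc, pow_succ]; ring

lemma bF_not_all (μ : ℝ) (hμ : -1 < μ) (a : ℂ) (h : ∀ n : ℕ, bF (μ + n) a = 0) : False := by
  have := Complex.taylorSeries_eq_of_entire (bF_differentiable μ hμ) a 0
  apply bF_zero μ hμ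
  rw [← this]
  simp [bF_iter μ hμ, h]

lemma bF_consec (μ : ℝ) (hμ : -1 < μ) (a : ℂ) (h0 : bF μ a = 0) (h1 : bF (μ+1) a = 0) : False := by
  have ha : a ≠ 0 := by rintro rfl; exact bF_zero μ hμ h0
  have : ∀ n : ℕ, bF (μ + n) a = 0 ∧ bF (μ + n + 1) a = 0 := by
    intro n
    induction n with
    | zero => simpa using ⟨h0, h1⟩
    | succ n ih =>
      have hn : (0:ℝ) ≤ n := n.cast_nonneg
      have := bF_rel (μ + n) (by linarith) a
      rw [ih.1, ih.2] at this
      push_cast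
      rw [← add_assoc]
      refine ⟨ih.2, ?_⟩
      have e : μ + n + 1 + 1 = μ + n + 2 := by ring
      rw [e]
      simpa [ha] using this
  exact bF_not_all μ hμ a (fun n => (this n).1)

lemma bF_simple (μ : ℝ) (hμ : -1 < μ) (a : ℂ) (h0 : bF μ a = 0) : deriv (bF μ) a ≠ 0 := by
  rw [(bF_hasDerivAt μ hμ a).deriv]
  intro h
  apply bF_consec μ hμ a h0
  simpa using h

/-- `y n = (x/2)^n F_{μ+n}(x²)` tends to zero. -/
lemma bF_seq_tendsto (μ : ℝ) (hμ : -1 < μ) (x z : ℂ) :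
    Tendsto (fun n : ℕ => x ^ n * bF (μ + n) z) atTop (𝓝 0) := by
  set r : ℝ := 2 * (‖x‖ + 1) with hr
  have hrpos : 0 < r := by positivity
  obtain ⟨B, hB⟩ := (pow_div_gam μ hμ r hrpos).tendsto_atTop_zero.bddAbove_range
  have hB0 : 0 ≤ B := le_trans (by have := gam_pos μ hμ 0; positivity) (hB ⟨0, rfl⟩)
  have hbd : ∀ n : ℕ, ‖x ^ n * bF (μ + n) z‖ ≤ (‖x‖ / r) ^ n * (B * Real.exp (‖z‖ / r)) := by
    intro n
    have hn : (0:ℝ) ≤ n := n.cast_nonneg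
    have hs : HasSum (fun m : ℕ => (1/r)^n * B * ((‖z‖ / r) ^ m / m.factorial))
        ((1/r)^n * B * Real.exp (‖z‖ / r)) := by
      apply HasSum.mul_left
      rw [Real.exp_eq_exp_ℝ]
      exact NormedSpace.expSeries_div_hasSum_exp (‖z‖ / r)
    have hle : ‖bF (μ + n) z‖ ≤ (1/r)^n * B * Real.exp (‖z‖ / r) := by
      refine (norm_tsum_le_tsum_norm (bF_norm_summable (μ + n) (by linarith) z)).trans ?_
      rw [← hs.tsum_eq]
      refine Summable.tsum_le_tsum (fun m => ?_) (bF_norm_summable (μ + n) (by linarith) z)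
        hs.summable
      rw [norm_mul, norm_pow, Complex.norm_real, Real.norm_eq_abs]
      have hG := gam_pos μ hμ (m + n)
      have h1 : r ^ (m + n) / Real.Gamma ((m + n : ℕ) + μ + 1) ≤ B := hB ⟨m + n, rfl⟩
      have e : |(-1/4 : ℝ)| = 1/4 := by norm_num [abs_div]
      have e2 : (m + (μ + n) + 1 : ℝ) = (m + n : ℕ) + μ + 1 := by push_cast; ring
      have h2 : |bc (μ + n) m| ≤ (1/r)^n * B * ((1/r)^m / m.factorial) := by
        unfold bc
        rw [e2, abs_div, abs_pow, e, abs_of_pos (mul_pos (by positivity) hG)]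
        calc (1/4 : ℝ)^m / (m.factorial * Real.Gamma ((m + n : ℕ) + μ + 1))
            ≤ 1 / (m.factorial * Real.Gamma ((m + n : ℕ) + μ + 1)) := by
              gcongr
              exact pow_le_one₀ (by norm_num) (by norm_num)
          _ = (1/r)^n * (r ^ (m + n) / Real.Gamma ((m + n : ℕ) + μ + 1))
                * ((1/r)^m / m.factorial) := by
              rw [pow_add, one_div_pow, one_div_pow]
              field_simp
          _ ≤ _ := by gcongr
      calc |bc (μ + n) m| * ‖z‖ ^ m ≤ (1/r)^n * B * ((1/r)^m / m.factorial) * ‖z‖ ^ m := by gcongr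
        _ = _ := by rw [div_pow ‖z‖, one_div, inv_pow, inv_pow]; field_simp
    rw [norm_mul, norm_pow]
    calc ‖x‖ ^ n * ‖bF (μ + n) z‖ ≤ ‖x‖ ^ n * ((1/r)^n * B * Real.exp (‖z‖ / r)) := by gcongr
      _ = _ := by rw [div_pow ‖x‖, one_div, inv_pow]; field_simp
  apply squeeze_zero_norm hbd
  have : Tendsto (fun n : ℕ => (‖x‖ / r) ^ n) atTop (𝓝 0) := by
    apply tendsto_pow_atTop_nhds_zero_of_lt_one (by positivity)
    rw [div_lt_one hrpos, hr]
    linarith [norm_nonneg x]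
  simpa using this.mul_const (B * Real.exp (‖z‖ / r))

lemma bF_zero_pos (μ : ℝ) (hμ : -1 < μ) (z : ℂ) (h0 : bF μ z = 0) :
    z.im = 0 ∧ 0 < z.re := by
  have hz : z ≠ 0 := by rintro rfl; exact bF_zero μ hμ h0
  obtain ⟨x, hx⟩ : ∃ x : ℂ, z = x ^ 2 := by
    obtain ⟨x, hx⟩ := IsAlgClosed.exists_pow_nat_eq z (n := 2) (by norm_num)
    exact ⟨x, hx.symm⟩
  have hx0 : x ≠ 0 := by rintro rfl; apply hz; simp [hx]
  suffices hxi : x.im = 0 by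
    have hxr : x.re ≠ 0 := by
      intro h; apply hx0; exact Complex.ext h hxi
    rw [hx, pow_two]
    constructor
    · simp [hxi]
    · simp [hxi]; positivity
  set G : ℕ → ℂ := fun n => (x/2) ^ n * bF (μ + n) z with hG
  have hrel : ∀ n : ℕ, G n + G (n+2) = (μ + n + 1) * (2 / x) * G (n+1) := by
    intro n
    have hn : (0:ℝ) ≤ n := n.cast_nonneg
    have := bF_rel (μ + n) (by linarith) z
    simp only [hG]
    push_cast at this ⊢
    rw [this, hx, ← add_assoc, ← add_assoc, pow_succ, pow_succ]
    field_simp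
    ring
  have hGt : Tendsto G atTop (𝓝 0) := bF_seq_tendsto μ hμ (x/2) z
  set T : ℕ → ℝ := fun n => (G n * (starRingEnd ℂ) (G (n+1))).im with hT
  have hTrec : ∀ n, T n - T (n+1) = (μ + n + 1) * (2 / x).im * Complex.normSq (G (n+1)) := by
    intro n
    have h1 := congrArg (fun t => (t * (starRingEnd ℂ) (G (n+1))).im) (hrel n)
    have e1 : (((μ:ℂ) + n + 1) * (2 / x) * G (n+1) * (starRingEnd ℂ) (G (n+1))).im
        = (μ + n + 1) * (2 / x).im * Complex.normSq (G (n+1)) := by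
      rw [mul_assoc, Complex.mul_conj]
      have : ((μ:ℂ) + n + 1) = ((μ + n + 1 : ℝ) : ℂ) := by push_cast; ring
      rw [this, mul_comm, ← mul_assoc, ← Complex.ofReal_mul, Complex.im_ofReal_mul]
      ring
    rw [← e1, ← h1]
    simp [hT, Complex.mul_im]
    ring
  have hT0 : T 0 = 0 := by
    simp [hT, hG, h0]
  have hTt : Tendsto T atTop (𝓝 0) := by
    have h1 : Tendsto (fun n => G n * (starRingEnd ℂ) (G (n+1))) atTop (𝓝 (0 * (starRingEnd ℂ) 0)) :=
      hGt.mul ((Complex.continuous_conj.tendsto 0).comp (hGt.comp (tendsto_add_atTop_nat 1)))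
    have h2 := (Complex.continuous_im.tendsto _).comp h1
    rw [map_zero, mul_zero, Complex.zero_im] at h2
    exact h2
  by_contra hxi
  have hc : (2 / x).im ≠ 0 := by
    rw [Complex.div_im]
    simp [hxi, hx0]
  set c := (2 / x).im with hcdef
  have hanti : Antitone (fun n => T n / c) := by
    apply antitone_nat_of_succ_le
    intro n
    have hn : (0:ℝ) ≤ n := n.cast_nonneg
    have h1 : T n / c - T (n+1) / c = (μ + n + 1) * Complex.normSq (G (n+1)) := by
      rw [← sub_div, hTrec n]; field_simp
    have h2 := Complex.normSq_nonneg (G (n+1))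
    have h3 : 0 ≤ (μ + n + 1) * Complex.normSq (G (n+1)) := mul_nonneg (by linarith) h2
    linarith
  have hlim : Tendsto (fun n => T n / c) atTop (𝓝 0) := by simpa using hTt.div_const c
  have h1a : 0 ≤ T 1 / c := hanti.le_of_tendsto hlim 1
  have h1b : T 1 / c ≤ T 0 / c := hanti (Nat.zero_le 1)
  rw [hT0, zero_div] at h1b
  have hT1 : T 1 = 0 := by
    have := le_antisymm h1b h1a
    field_simp at this
    simpa using this
  have := hTrec 0
  rw [zero_add, hT0, hT1, sub_zero] at this
  have hμ1 : μ + 1 ≠ 0 := by linarith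
  have hG1 : G 1 = 0 := by
    have h := this.symm
    simp only [Nat.cast_zero, add_zero, mul_eq_zero, hμ1, hc, false_or,
      Complex.normSq_eq_zero] at h
    exact h
  apply bF_consec μ hμ z h0
  simpa [hG, hx0] using hG1

noncomputable def bR (μ t : ℝ) : ℝ := ∑' m : ℕ, bc μ m * t ^ m

lemma bF_ofReal (μ t : ℝ) : bF μ t = (bR μ t : ℂ) := by
  unfold bF bR
  push_cast
  rfl

lemma besselJ_eq (ν x : ℝ) (hx : 0 < x) : besselJ ν x = (x/2)^ν * bR ν (x^2) := by
  unfold besselJ bR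
  rw [← tsum_mul_left]
  congr 1; funext m
  have e : (x/2) ^ (2 * (m:ℝ) + ν) = (x/2)^ν * ((x/2)^2)^m := by
    rw [Real.rpow_add (by positivity), Real.rpow_mul (by positivity), Real.rpow_natCast]
    norm_num
    ring
  rw [e]
  unfold bc
  have e2 : ((x/2)^2)^m * (-1)^m = (-1/4)^m * (x^2)^m := by
    rw [← mul_pow, ← mul_pow]; congr 1; ring
  rw [div_mul_eq_mul_div, div_mul_eq_mul_div, mul_div_assoc', ← e2]
  congr 1; ring

lemma besselI_eq (ν x : ℝ) (hx : 0 < x) : besselI ν x = (x/2)^ν * bR ν (-x^2) := by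
  unfold besselI bR
  rw [← tsum_mul_left]
  congr 1; funext m
  have e : (x/2) ^ (2 * (m:ℝ) + ν) = (x/2)^ν * ((x/2)^2)^m := by
    rw [Real.rpow_add (by positivity), Real.rpow_mul (by positivity), Real.rpow_natCast]
    norm_num
    ring
  rw [e]
  unfold bc
  have e2 : ((x/2)^2)^m * 1 = (-1/4)^m * (-x^2)^m := by
    rw [mul_one, ← mul_pow]; congr 1; ring
  rw [div_mul_eq_mul_div, div_mul_eq_mul_div, mul_div_assoc', ← e2]
  congr 1; ring

lemma bF_zeros_finite (μ : ℝ) (hμ : -1 < μ) (R : ℝ) :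
    {z : ℂ | bF μ z = 0 ∧ ‖z‖ ≤ R}.Finite := by
  by_contra hinf
  have hsub : {z : ℂ | bF μ z = 0 ∧ ‖z‖ ≤ R} ⊆ closedBall 0 R := by
    intro z hz; simpa using hz.2
  obtain ⟨a, _, ha⟩ := Set.Infinite.exists_accPt_of_subset_isCompact hinf
    (isCompact_closedBall (0:ℂ) R) hsub
  have hfr : ∃ᶠ z in 𝓝[≠] a, bF μ z = 0 := by
    have := accPt_iff_frequently_nhdsNE.1 ha
    exact this.mono (fun z hz => hz.1)
  have han : AnalyticOnNhd ℂ (bF μ) Set.univ :=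
    (bF_differentiable μ hμ).differentiableOn.analyticOnNhd isOpen_univ
  have := han.eqOn_zero_of_preconnected_of_frequently_eq_zero isPreconnected_univ
    (Set.mem_univ a) hfr
  exact bF_zero μ hμ (this (Set.mem_univ 0))

theorem quartic_mittag_leffler (ν : ℝ) (hν : -1 < ν) (x : ℝ) (hx : 0 < x)
    (hJx : besselJ ν x ≠ 0) :
    ∑' j : {j : ℝ // 0 < j ∧ besselJ ν j = 0}, (1 : ℝ) / ((j : ℝ) ^ 4 - x ^ 4)
      = (1 / (4 * x ^ 3)) *
          (besselJ (ν + 1) x / besselJ ν x - besselI (ν + 1) x / besselI ν x) := by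
  set F := bF ν with hFdef
  have hdF := bF_differentiable ν hν
  set S : ℕ → Finset ℂ := fun n => (bF_zeros_finite ν hν n).toFinset with hSdef
  have hS : ∀ n z, z ∈ S n ↔ bF ν z = 0 ∧ ‖z‖ ≤ n := by
    intro n z; simp [hSdef]
  have hJ : ∀ t : ℝ, 0 < t → (besselJ ν t = 0 ↔ bF ν ((t:ℂ)^2) = 0) := by
    intro t ht
    have h1 : ((t:ℂ)^2) = ((t^2 : ℝ) : ℂ) := by push_cast; ring
    have h2 : (t/2)^ν ≠ 0 := (Real.rpow_pos_of_pos (by positivity) _).ne'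
    rw [h1, bF_ofReal, besselJ_eq ν t ht, Complex.ofReal_eq_zero]
    simp [h2]
  set i : {j : ℝ // 0 < j ∧ besselJ ν j = 0} → ℂ := fun j => ((j:ℝ):ℂ)^2 with hi
  have hinj : Function.Injective i := by
    intro j k hjk
    simp only [hi] at hjk
    have h1 : (j:ℝ)^2 = (k:ℝ)^2 := by exact_mod_cast hjk
    exact Subtype.ext ((pow_left_inj₀ j.2.1.le k.2.1.le two_ne_zero).1 h1)
  have hsurj : ∀ z, bF ν z = 0 → z ∈ Set.range i := by
    intro z hz
    obtain ⟨him, hre⟩ := bF_zero_pos ν hν z hz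
    have hsq : ((Real.sqrt z.re : ℝ) : ℂ)^2 = z := by
      rw [← Complex.ofReal_pow, Real.sq_sqrt hre.le]
      apply Complex.ext <;> simp [him]
    have hpos : 0 < Real.sqrt z.re := Real.sqrt_pos.2 hre
    exact ⟨⟨Real.sqrt z.re, hpos, (hJ _ hpos).2 (by rw [hsq]; exact hz)⟩, hsq⟩
  set T : ℕ → Finset {j : ℝ // 0 < j ∧ besselJ ν j = 0} :=
    fun n => (S n).preimage i hinj.injOn with hTdef
  have hT : ∀ n j, j ∈ T n ↔ (j:ℝ)^2 ≤ n := by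
    intro n j
    have h1 : bF ν (i j) = 0 := (hJ _ j.2.1).1 j.2.2
    have h2 : ‖i j‖ = (j:ℝ)^2 := by
      simp [hi]
    rw [hTdef, Finset.mem_preimage, hS, h2]
    simp [h1]
  have hsum : ∀ (n : ℕ) (g : ℂ → ℂ), ∑ j ∈ T n, g (i j) = ∑ a ∈ S n, g a := by
    intro n g
    apply Finset.sum_preimage
    intro a ha hna
    exact absurd (hsurj a ((hS n a).1 ha).1) hna
  have hx2 : bF ν ((x^2 : ℝ) : ℂ) ≠ 0 := by
    intro h; apply hJx; rw [hJ x hx, ← h]; push_cast; rfl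
  have hx2' : bF ν ((-x^2 : ℝ) : ℂ) ≠ 0 := by
    intro h
    have := (bF_zero_pos ν hν _ h).2
    rw [Complex.ofReal_re] at this
    nlinarith [sq_nonneg x]
  have t1 := ml_tendsto (bF ν) hdF (bF_zero ν hν) (bF_simple ν hν) (bF_growth ν hν) S hS _ hx2
  have t2 := ml_tendsto (bF ν) hdF (bF_zero ν hν) (bF_simple ν hν) (bF_growth ν hν) S hS _ hx2'
  rw [(bF_hasDerivAt ν hν _).deriv, bF_ofReal, bF_ofReal] at t1 t2
  have t3 := ((t2.sub t1).const_mul ((1 / (2 * x^2) : ℝ) : ℂ))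
  have t4 := (Complex.continuous_re.tendsto _).comp t3
  have hne1 : bR ν (x^2) ≠ 0 := by rw [bF_ofReal] at hx2; exact_mod_cast hx2
  have hne2 : bR ν (-x^2) ≠ 0 := by rw [bF_ofReal] at hx2'; exact_mod_cast hx2'
  have hL : (((1 / (2 * x^2) : ℝ) : ℂ) * ((-1/4) * (bR (ν+1) (-x^2) : ℂ) / (bR ν (-x^2) : ℂ)
      - (-1/4) * (bR (ν+1) (x^2) : ℂ) / (bR ν (x^2) : ℂ))).re
      = (1 / (4 * x ^ 3)) *
          (besselJ (ν + 1) x / besselJ ν x - besselI (ν + 1) x / besselI ν x) := by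
    have e : (((1 / (2 * x^2) : ℝ) : ℂ) * ((-1/4) * (bR (ν+1) (-x^2) : ℂ) / (bR ν (-x^2) : ℂ)
      - (-1/4) * (bR (ν+1) (x^2) : ℂ) / (bR ν (x^2) : ℂ))) =
      (((1 / (2 * x^2)) * ((-1/4) * bR (ν+1) (-x^2) / bR ν (-x^2)
      - (-1/4) * bR (ν+1) (x^2) / bR ν (x^2)) : ℝ) : ℂ) := by push_cast; ring
    rw [e, Complex.ofReal_re, besselJ_eq _ x hx, besselJ_eq _ x hx, besselI_eq _ x hx,
      besselI_eq _ x hx, Real.rpow_add_one (by positivity)]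
    have h2 : (x/2)^ν ≠ 0 := (Real.rpow_pos_of_pos (by positivity) _).ne'
    field_simp
    ring
  rw [hL] at t4
  obtain ⟨n₀, hn₀⟩ := exists_nat_gt (x^2)
  apply HasSum.tsum_eq
  apply hasSum_of_exhaust _ T ?_ ?_ _ ?_ n₀ ?_
  · intro m n hmn j hj
    rw [hT] at hj ⊢
    have : (m:ℝ) ≤ n := by exact_mod_cast hmn
    linarith
  · intro j
    obtain ⟨n, hn⟩ := exists_nat_gt ((j:ℝ)^2)
    exact ⟨n, (hT n j).2 hn.le⟩
  · refine t4.congr ?_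
    intro n
    simp only [Function.comp_apply]
    rw [← hsum n (fun a => 1 / (((-x^2 : ℝ) : ℂ) - a)), ← hsum n (fun a => 1 / (((x^2 : ℝ) : ℂ) - a)),
      ← Finset.sum_sub_distrib, Finset.mul_sum, Complex.re_sum]
    apply Finset.sum_congr rfl
    intro j _
    have e : (((1 / (2 * x^2) : ℝ) : ℂ) * (1 / (((-x^2 : ℝ) : ℂ) - i j) - 1 / (((x^2 : ℝ) : ℂ) - i j)))
      = (((1 / (2 * x^2)) * (1 / (-x^2 - (j:ℝ)^2) - 1 / (x^2 - (j:ℝ)^2)) : ℝ) : ℂ) := by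
      simp only [hi]
      push_cast; ring
    rw [e, Complex.ofReal_re]
    have hjx : (j:ℝ)^2 - x^2 ≠ 0 := by
      intro h
      have h1 : bF ν (i j) = 0 := (hJ _ j.2.1).1 j.2.2
      apply hx2
      rw [← h1]
      simp only [hi]
      congr 1
      have : x^2 = (j:ℝ)^2 := by linarith
      rw [this]; push_cast; rfl
    have hjp : (j:ℝ)^2 + x^2 ≠ 0 := by positivity
    have e1 : -x^2 - (j:ℝ)^2 = -((j:ℝ)^2 + x^2) := by ring
    have e2 : x^2 - (j:ℝ)^2 = -((j:ℝ)^2 - x^2) := by ring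
    have e3 : (j:ℝ)^4 - x^4 = ((j:ℝ)^2 - x^2) * ((j:ℝ)^2 + x^2) := by ring
    rw [e1, e2, e3]
    field_simp
    ring
  · intro j hj
    rw [hT, not_le] at hj
    apply one_div_nonneg.2
    have : (j:ℝ)^4 - x^4 = ((j:ℝ)^2 - x^2) * ((j:ℝ)^2 + x^2) := by ring
    rw [this]
    apply mul_nonneg
    · linarith
    · positivity
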